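/- arXiv:1602.07365 — 2 statements merged into one kernel-verified Lean document; each statement's English description precedes it below -/
import Mathlib

section
/- Let C be a compact convex set in the plane ℝ² with nonempty interior, and let A and B be two distinct homothets of C. Then the intersection of the boundaries ∂A ∩ ∂B can be written as the union of two sets, each of which is either a closed line segment, a single point, or empty. -/
noncomputable section

open Real

/-- Points in the plane `ℝ²` with the Euclidean distance. -/
abbrev Pt : Type := EuclideanSpace ℝ (Fin 2)

/-- Two segments `pq` and `rs` intersect properly if they meet in a point lying in the
relative interior of both segments. -/
def properInter (p q r s : Pt) : Prop :=
  (openSegment ℝ p q ∩ openSegment ℝ r s).Nonempty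

/-- Two points `u` and `v` are visible to each other (with respect to the set of
constraints `S`) if the segment `uv` is a constraint or `uv` does not properly
intersect any constraint of `S`. -/
def Visible (S : Set (Pt × Pt)) (u v : Pt) : Prop :=
  (u, v) ∈ S ∨ (v, u) ∈ S ∨ ∀ c ∈ S, ¬ properInter u v c.1 c.2

/-- `A` is a homothet of `C`, i.e. `A = x + l • C` for some `l > 0` and translation `x`. -/
def IsHomothet (C A : Set Pt) : Prop :=
  ∃ (x : Pt) (l : ℝ), 0 < l ∧ A = (fun z => x + l • z) '' C

lemma hm_seg {A : Set Pt} (hA : Convex ℝ A) (z v : Pt) {a b c : ℝ}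
    (ha : z + a • v ∈ interior A) (hb : z + b • v ∈ A)
    (h : (a ≤ c ∧ c < b) ∨ (b < c ∧ c ≤ a)) : z + c • v ∈ interior A := by
  have hne : b - a ≠ 0 := by
    rcases h with h | h
    · have : 0 < b - a := by linarith
      exact this.ne'
    · have : b - a < 0 := by linarith
      exact this.ne
  have e : z + c • v = ((b - c) / (b - a)) • (z + a • v) + ((c - a) / (b - a)) • (z + b • v) := by
    have h1 : (b - c) / (b - a) = 1 - (c - a) / (b - a) := by field_simp; ring
    have h2 : c = a + (c - a) / (b - a) * (b - a) := by field_simp; ring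
    rw [h1]
    generalize (c - a) / (b - a) = t at *
    subst h2
    module
  rw [e]
  refine hA.combo_interior_self_mem_interior ha hb ?_ ?_ ?_
  · rcases h with h | h
    · apply div_pos <;> linarith
    · apply div_pos_of_neg_of_neg <;> linarith
  · rcases h with h | h
    · apply div_nonneg <;> linarith
    · apply div_nonneg_of_nonpos <;> linarith
  · field_simp; ring

lemma hm_three {A : Set Pt} (hA : Convex ℝ A) (z v : Pt) {a b c t : ℝ}
    (ha : z + a • v ∈ A) (hb : z + b • v ∉ interior A) (hc : z + c • v ∈ A)
    (hab : a < b) (hbc : b < c) : z + t • v ∉ interior A := by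
  intro h
  rcases le_total t b with h1 | h1
  · exact hb (hm_seg hA z v h hc (Or.inl ⟨h1, hbc⟩))
  · exact hb (hm_seg hA z v h ha (Or.inr ⟨hab, h1⟩))

lemma hm_key {A : Set Pt} (hA : Convex ℝ A) {r : ℝ} (hr0 : 0 < r) (hr1 : r ≤ 1) (d z y : Pt)
    {s : ℝ} (hz : z ∈ interior A) (hz' : r • z + d ∈ interior A)
    (hy : y ∈ A) (hy' : r • y + d ∈ A) (hyn : y ∉ interior A) (hyn' : r • y + d ∉ interior A)
    (hys : y = z + s • (z - (r • z + d))) (hs : 1 + s - r * s ≠ 0) : False := by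
  set v := z - (r • z + d) with hv
  have e0 : z = z + (0:ℝ) • v := by simp
  have e1 : r • z + d = z + (-1:ℝ) • v := by rw [hv]; module
  have e2 : r • y + d = z + (r * s - 1) • v := by rw [hys, hv]; module
  rw [e2] at hy' hyn'
  rw [hys] at hy hyn
  rw [e1] at hz'
  rw [e0] at hz
  rcases le_or_gt 0 s with h | h
  · exact hyn' (hm_seg hA z v hz' hy (Or.inl ⟨by nlinarith, by nlinarith⟩))
  · rcases lt_or_gt_of_ne hs with h1 | h1
    · exact hyn' (hm_seg hA z v hz hy (Or.inr ⟨by linarith, by nlinarith⟩))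
    · exact hyn (hm_seg hA z v hz hy' (Or.inr ⟨by linarith, by linarith⟩))

/-- cross product -/
def hmcr (u w : Pt) : ℝ := u 0 * w 1 - u 1 * w 0

lemma hmcr_zero {u w : Pt} (hu : u ≠ 0) (h : hmcr u w = 0) : ∃ s : ℝ, w = s • u := by
  unfold hmcr at h
  have hn : u 0 * u 0 + u 1 * u 1 ≠ 0 := by
    intro h0
    apply hu
    ext i
    fin_cases i
    · simp; nlinarith [mul_self_nonneg (u 0), mul_self_nonneg (u 1)]
    · simp; nlinarith [mul_self_nonneg (u 0), mul_self_nonneg (u 1)]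
  refine ⟨(u 0 * w 0 + u 1 * w 1) / (u 0 * u 0 + u 1 * u 1), ?_⟩
  ext i
  fin_cases i
  · simp only [Fin.zero_eta, Fin.mk_one, PiLp.smul_apply, smul_eq_mul]
    rw [div_mul_eq_mul_div, eq_div_iff hn]
    linear_combination (- u 1) * h
  · simp only [Fin.zero_eta, Fin.mk_one, PiLp.smul_apply, smul_eq_mul]
    rw [div_mul_eq_mul_div, eq_div_iff hn]
    linear_combination (u 0) * h

/-- compact convex sets with empty interior -/
lemma hm_isSeg (S : Set Pt) (hc : IsCompact S) (hS : Convex ℝ S) (hi : interior S = ∅) :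
    (∃ a b : Pt, S = segment ℝ a b) ∨ (∃ a : Pt, S = {a}) ∨ S = ∅ := by
  rcases S.eq_empty_or_nonempty with h | hne
  · exact Or.inr (Or.inr h)
  left
  have hspan : affineSpan ℝ S ≠ ⊤ := by
    intro h
    have := hS.interior_nonempty_iff_affineSpan_eq_top.2 h
    rw [hi] at this
    exact Set.not_nonempty_empty this
  obtain ⟨p0, hp0⟩ := hne
  have hcol : Collinear ℝ S := by
    rw [collinear_iff_finrank_le_one]
    by_contra hcon
    apply hspan
    have hd : vectorSpan ℝ S = ⊤ := by
      apply Submodule.eq_top_of_finrank_eq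
      have h1 := Submodule.finrank_le (vectorSpan ℝ S)
      have h2 : Module.finrank ℝ Pt = 2 := by simp
      omega
    exact (AffineSubspace.affineSpan_eq_top_iff_vectorSpan_eq_top_of_nonempty ℝ Pt Pt ⟨p0, hp0⟩).2 hd
  obtain ⟨v, hv⟩ := (collinear_iff_of_mem hp0).1 hcol
  have hcont : ContinuousOn (fun x : Pt => inner ℝ v x) S := by fun_prop
  obtain ⟨a, ha, hamin⟩ := hc.exists_isMinOn ⟨p0, hp0⟩ hcont
  obtain ⟨b, hb, hbmax⟩ := hc.exists_isMaxOn ⟨p0, hp0⟩ hcont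
  refine ⟨a, b, Set.Subset.antisymm ?_ (hS.segment_subset ha hb)⟩
  intro x hx
  have h1 := hamin hx
  have h2 := hbmax hx
  obtain ⟨ra, hra⟩ := hv a ha
  obtain ⟨rb, hrb⟩ := hv b hb
  obtain ⟨rx, hrx⟩ := hv x hx
  by_cases hv0 : v = 0
  · subst hv0
    simp at hra hrb hrx
    rw [hra, hrb, hrx]; simp
  have hpos : 0 < inner ℝ v v := real_inner_self_pos.2 hv0
  simp only [Set.mem_ofPred_eq, hra, hrb, hrx, vadd_eq_add, inner_add_right, inner_smul_right] at h1 h2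
  have h1' : ra ≤ rx := by
    by_contra h; push Not at h; nlinarith
  have h2' : rx ≤ rb := by
    by_contra h; push Not at h; nlinarith
  rcases eq_or_lt_of_le (h1'.trans h2') with h | h
  · have : rx = ra := by linarith
    rw [hrx, this, ← hra]; exact left_mem_segment ℝ a b
  · refine ⟨(rb - rx) / (rb - ra), (rx - ra) / (rb - ra), div_nonneg (by linarith) (by linarith),
      div_nonneg (by linarith) (by linarith), ?_, ?_⟩
    · have : rb - ra ≠ 0 := by linarith
      field_simp; ring
    · have h0 : rb - ra ≠ 0 := by linarith
      have h1 : (rb - rx) / (rb - ra) = 1 - (rx - ra) / (rb - ra) := by field_simp; ring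
      have h2 : rx = ra + (rx - ra) / (rb - ra) * (rb - ra) := by field_simp; ring
      rw [h1, hra, hrb, hrx]
      generalize (rx - ra) / (rb - ra) = t at *
      subst h2
      simp only [vadd_eq_add]
      module

/-- trichotomy half -/
lemma hm_tri {A : Set Pt} (hA : Convex ℝ A) {r : ℝ} (hr0 : 0 < r) (hr1 : r ≤ 1) (d q x y : Pt)
    (hq : q ∈ interior A) (hq' : r • q + d ∈ interior A) (hvq : q - (r • q + d) ≠ 0)
    (hx : x ∈ A) (hx' : r • x + d ∈ A)
    (hy : y ∈ A) (hy' : r • y + d ∈ A) (hyn : y ∉ interior A) (hyn' : r • y + d ∉ interior A)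
    (ε : ℝ)
    (hfx : 0 < ε * hmcr (q - (r • q + d)) (x - q)) (hfy : 0 < ε * hmcr (q - (r • q + d)) (y - q))
    (hg : ε * hmcr (x - (r • x + d)) (y - x) < 0) : False := by
  set F := hmcr (q - (r • q + d)) (y - q) with hF
  set G := hmcr (x - (r • x + d)) (y - x) with hG
  have hFG : 0 < ε * F - ε * G := by linarith
  set s := ε * F / (ε * F - ε * G) with hs
  have hs0 : 0 < s := div_pos hfy hFG
  have hs1 : s < 1 := by rw [hs, div_lt_one hFG]; linarith
  have hsF : (1 - s) * F + s * G = 0 := by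
    have hε : ε ≠ 0 := by rintro rfl; simp at hfy
    have : ε * ((1 - s) * F + s * G) = 0 := by
      have h3 : s * (ε * F - ε * G) = ε * F := div_mul_cancel₀ _ hFG.ne'
      linear_combination -h3
    exact (mul_eq_zero.1 this).resolve_left hε
  set z := (1 - s) • q + s • x with hz
  have hzi : z ∈ interior A :=
    hA.combo_interior_self_mem_interior hq hx (by linarith) hs0.le (by ring)
  have hzi' : r • z + d ∈ interior A := by
    have : r • z + d = (1 - s) • (r • q + d) + s • (r • x + d) := by rw [hz]; module
    rw [this]
    exact hA.combo_interior_self_mem_interior hq' hx' (by linarith) hs0.le (by ring)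
  have hfz : hmcr (q - (r • q + d)) (z - q) = s * hmcr (q - (r • q + d)) (x - q) := by
    rw [hz]; simp [hmcr]; ring
  have hfz0 : hmcr (q - (r • q + d)) (z - q) ≠ 0 := by
    rw [hfz]; intro h
    rcases mul_eq_zero.1 h with h | h
    · linarith
    · rw [h] at hfx; simp at hfx
  have hvz : z - (r • z + d) ≠ 0 := by
    intro h
    have h1 : q - (r • q + d) = -((1 - r) • (z - q)) := by
      have : q - (r • q + d) = (z - (r • z + d)) - (1 - r) • (z - q) := by module
      rw [this, h]; simp
    apply hfz0
    rw [h1]; simp [hmcr]; ring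
  have hcz : hmcr (z - (r • z + d)) (y - z) = 0 := by
    rw [← hsF, hF, hG, hz]; simp [hmcr]; ring
  obtain ⟨t, ht⟩ := hmcr_zero hvz hcz
  have hyt : y = z + t • (z - (r • z + d)) := by rw [← ht]; abel
  refine hm_key hA hr0 hr1 d z y hzi hzi' hy hy' hyn hyn' hyt ?_
  intro h0
  have : F = (1 + t - r * t) * hmcr (q - (r • q + d)) (z - q) := by
    rw [hF, hyt]; simp [hmcr]; ring
  rw [h0] at this
  rw [this] at hfy
  simp at hfy

lemma hm_conv {A : Set Pt} (hA : Convex ℝ A) (hAc : IsClosed A) {r : ℝ} (hr0 : 0 < r)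
    (hr1 : r ≤ 1) (d q : Pt)
    (hq : q ∈ interior A) (hq' : r • q + d ∈ interior A) (hvq : q - (r • q + d) ≠ 0) (ε : ℝ)
    (hε : ε ≠ 0) :
    Convex ℝ {x : Pt | x ∈ frontier A ∧ r • x + d ∈ frontier A ∧
      0 ≤ ε * hmcr (q - (r • q + d)) (x - q)} := by
  have hfr : ∀ x, x ∈ frontier A ↔ x ∈ A ∧ x ∉ interior A := by
    intro x; rw [hAc.frontier_eq]; rfl
  -- points on the line are fixed points
  have hline : ∀ x, x ∈ frontier A → r • x + d ∈ frontier A →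
      hmcr (q - (r • q + d)) (x - q) = 0 → x - (r • x + d) = 0 := by
    intro x hx hx' h0
    rw [hfr] at hx hx'
    obtain ⟨s, hs⟩ := hmcr_zero hvq h0
    have hxs : x = q + s • (q - (r • q + d)) := by rw [← hs]; abel
    by_cases h1 : 1 + s - r * s = 0
    · have : x - (r • x + d) = (1 + s - r * s) • (q - (r • q + d)) := by rw [hxs]; module
      rw [this, h1, zero_smul]
    · exact (hm_key hA hr0 hr1 d q x hq hq' hx.1 hx'.1 hx.2 hx'.2 hxs h1).elim
  have main : ∀ x y : Pt, x ∈ frontier A → r • x + d ∈ frontier A →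
      0 ≤ ε * hmcr (q - (r • q + d)) (x - q) → y ∈ frontier A → r • y + d ∈ frontier A →
      0 ≤ ε * hmcr (q - (r • q + d)) (y - q) → x - (r • x + d) ≠ 0 →
      ∀ a b : ℝ, 0 ≤ a → 0 ≤ b → a + b = 1 →
      a • x + b • y ∈ frontier A ∧ r • (a • x + b • y) + d ∈ frontier A := by
    intro x y hx hx' hfx hy hy' hfy hvx a b ha hb hab
    have hfx1 : 0 < ε * hmcr (q - (r • q + d)) (x - q) := by
      refine lt_of_le_of_ne hfx fun h => hvx (hline x hx hx' ?_)
      exact (mul_eq_zero.1 h.symm).resolve_left hε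
    have hs : ∃ s : ℝ, y = x + s • (x - (r • x + d)) ∧ 0 ≤ 1 + s - r * s := by
      by_cases hvy : y - (r • y + d) = 0
      · have hr : 1 - r ≠ 0 := by
          intro h
          apply hvx
          have : x - (r • x + d) = (y - (r • y + d)) + (1 - r) • (x - y) := by module
          rw [this, hvy, h]; simp
        refine ⟨-(1 / (1 - r)), ?_, ?_⟩
        · have : x - (r • x + d) = (1 - r) • (x - y) := by
            have : x - (r • x + d) = (y - (r • y + d)) + (1 - r) • (x - y) := by module
            rw [this, hvy]; simp
          rw [this, smul_smul]
          have : -(1 / (1 - r)) * (1 - r) = -1 := by field_simp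
          rw [this]; module
        · apply le_of_eq; field_simp; ring
      · have hfy1 : 0 < ε * hmcr (q - (r • q + d)) (y - q) := by
          refine lt_of_le_of_ne hfy fun h => hvy (hline y hy hy' ?_)
          exact (mul_eq_zero.1 h.symm).resolve_left hε
        rw [hfr] at hx hx' hy hy'
        have hanti : hmcr (y - (r • y + d)) (x - y) = - hmcr (x - (r • x + d)) (y - x) := by
          simp [hmcr]; ring
        have hg0 : ε * hmcr (x - (r • x + d)) (y - x) = 0 := by
          rcases lt_trichotomy (ε * hmcr (x - (r • x + d)) (y - x)) 0 with h | h | h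
          · exact (hm_tri hA hr0 hr1 d q x y hq hq' hvq hx.1 hx'.1 hy.1 hy'.1 hy.2 hy'.2 ε
              hfx1 hfy1 h).elim
          · exact h
          · exact (hm_tri hA hr0 hr1 d q y x hq hq' hvq hy.1 hy'.1 hx.1 hx'.1 hx.2 hx'.2 ε
              hfy1 hfx1 (by rw [hanti]; linarith)).elim
        obtain ⟨s, hs⟩ := hmcr_zero hvx ((mul_eq_zero.1 hg0).resolve_left hε)
        have hys : y = x + s • (x - (r • x + d)) := by rw [← hs]; abel
        refine ⟨s, hys, ?_⟩
        have : ε * hmcr (q - (r • q + d)) (y - q) =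
            (1 + s - r * s) * (ε * hmcr (q - (r • q + d)) (x - q)) := by
          rw [hys]; simp [hmcr]; ring
        rw [this] at hfy
        exact nonneg_of_mul_nonneg_left hfy hfx1
    obtain ⟨s, hys, hs⟩ := hs
    rw [hfr] at hx hx' hy hy' ⊢
    rw [hfr]
    have hmem : a • x + b • y ∈ A := hA hx.1 hy.1 ha hb hab
    have hmem' : r • (a • x + b • y) + d ∈ A := by
      have : r • (a • x + b • y) + d = a • (r • x + d) + b • (r • y + d) := by
        have : a = 1 - b := by linarith
        subst this; module
      rw [this]; exact hA hx'.1 hy'.1 ha hb hab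
    rcases eq_or_ne s 0 with h0 | h0
    · have : y = x := by rw [hys, h0]; simp
      have e : a • x + b • y = x := by rw [this, ← add_smul, hab, one_smul]
      rw [e]; exact ⟨hx, hx'⟩
    have e : a • x + b • y = x + (b * s) • (x - (r • x + d)) := by
      have : a = 1 - b := by linarith
      rw [hys]; subst this; module
    have e' : r • (a • x + b • y) + d = x + (r * (b * s) - 1) • (x - (r • x + d)) := by
      rw [e]; module
    have key : ∀ t : ℝ, x + t • (x - (r • x + d)) ∉ interior A := by
      intro t
      have e0 : x = x + (0:ℝ) • (x - (r • x + d)) := by simp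
      have e1 : r • x + d = x + (-1:ℝ) • (x - (r • x + d)) := by module
      have e2 : r • y + d = x + (r * s - 1) • (x - (r • x + d)) := by rw [hys]; module
      have hx1 := hx; have hx1' := hx'; have hy1 := hy; have hy1' := hy'
      rw [e0] at hx1
      rw [e1] at hx1'
      rw [hys] at hy1
      rw [e2] at hy1'
      rcases lt_or_gt_of_ne h0 with h | h
      · exact hm_three hA x _ hy1'.1 hx1'.2 hx1.1 (by nlinarith) (by norm_num)
      · exact hm_three hA x _ hx1'.1 hx1.2 hy1.1 (by norm_num) h
    exact ⟨⟨hmem, by rw [e]; exact key _⟩, ⟨hmem', by rw [e']; exact key _⟩⟩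
  rintro x ⟨hx, hx', hfx⟩ y ⟨hy, hy', hfy⟩ a b ha hb hab
  have hf : 0 ≤ ε * hmcr (q - (r • q + d)) (a • x + b • y - q) := by
    have : ε * hmcr (q - (r • q + d)) (a • x + b • y - q) =
        a * (ε * hmcr (q - (r • q + d)) (x - q)) + b * (ε * hmcr (q - (r • q + d)) (y - q)) := by
      have : a = 1 - b := by linarith
      subst this
      simp [hmcr]; ring
    rw [this]; positivity
  have : a • x + b • y ∈ frontier A ∧ r • (a • x + b • y) + d ∈ frontier A := by
    by_cases hvx : x - (r • x + d) = 0
    · by_cases hvy : y - (r • y + d) = 0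
      · have hxy : (1 - r) • (x - y) = 0 := by
          have : (1 - r) • (x - y) = (x - (r • x + d)) - (y - (r • y + d)) := by module
          rw [this, hvx, hvy]; simp
        rcases smul_eq_zero.1 hxy with h | h
        · exfalso; apply hvq
          have : q - (r • q + d) = (x - (r • x + d)) + (1 - r) • (q - x) := by module
          rw [this, hvx, h]; simp
        · have h : x = y := sub_eq_zero.1 h
          have e : a • x + b • y = x := by rw [← h, ← add_smul, hab, one_smul]
          rw [e]; exact ⟨hx, hx'⟩
      · have := main y x hy hy' hfy hx hx' hfx hvy b a hb ha (by linarith)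
        rwa [add_comm (b • y)] at this
    · exact main x y hx hx' hfx hy hy' hfy hvx a b ha hb hab
  exact ⟨this.1, this.2, hf⟩

lemma hm_main {A B : Set Pt} (hA : Convex ℝ A) (hAc : IsCompact A) (hAi : (interior A).Nonempty)
    {r : ℝ} (hr0 : 0 < r) (hr1 : r ≤ 1) (d : Pt) (hB : B = (fun x => r • x + d) ⁻¹' A)
    (hAB : A ≠ B) :
    ∃ S₁ S₂ : Set Pt, frontier A ∩ frontier B = S₁ ∪ S₂ ∧
      ((∃ a b : Pt, S₁ = segment ℝ a b) ∨ (∃ a : Pt, S₁ = {a}) ∨ S₁ = ∅) ∧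
      ((∃ a b : Pt, S₂ = segment ℝ a b) ∨ (∃ a : Pt, S₂ = {a}) ∨ S₂ = ∅) := by
  let φ : Pt ≃ₜ Pt := (Homeomorph.smulOfNeZero r hr0.ne').trans (Homeomorph.addRight d)
  have hφ : ∀ x, φ x = r • x + d := fun x => rfl
  have hB' : B = φ ⁻¹' A := hB
  have hfB : frontier B = φ ⁻¹' frontier A := by rw [hB', φ.preimage_frontier]
  have hiB : interior B = φ ⁻¹' interior A := by rw [hB', φ.preimage_interior]
  have hAcl := hAc.isClosed
  have hfi : interior (frontier A) = ∅ := interior_frontier hAcl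
  have hfc : IsCompact (frontier A) := hAc.of_isClosed_subset isClosed_frontier hAcl.frontier_subset
  have hBcl : IsClosed B := by rw [hB']; exact hAcl.preimage φ.continuous
  have hBconv : Convex ℝ B := by
    rw [hB]
    intro x hx y hy a b ha hb hab
    have : r • (a • x + b • y) + d = a • (r • x + d) + b • (r • y + d) := by
      have : a = 1 - b := by linarith
      subst this; module
    show r • (a • x + b • y) + d ∈ A
    rw [this]; exact hA hx hy ha hb hab
  by_cases hdis : (interior A ∩ interior B).Nonempty
  · obtain ⟨q, hq, hq'⟩ := hdis
    rw [hiB] at hq'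
    have hq' : r • q + d ∈ interior A := hq'
    by_cases hvq : q - (r • q + d) = 0
    · refine ⟨∅, ∅, ?_, Or.inr (Or.inr rfl), Or.inr (Or.inr rfl)⟩
      rw [Set.union_empty, Set.eq_empty_iff_forall_notMem]
      rintro y ⟨hy, hy'⟩
      rw [hfB] at hy'
      have hy' : r • y + d ∈ frontier A := hy'
      rw [hAcl.frontier_eq] at hy hy'
      have e : r • y + d = (1 - r) • q + r • y := by
        have : r • y + d = (1 - r) • q + r • y - (q - (r • q + d)) := by module
        rw [this, hvq]; simp
      rcases eq_or_lt_of_le hr1 with h | h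
      · apply hAB
        rw [hB]
        have hd : d = 0 := by
          subst h
          simpa using hvq
        ext x; simp [h, hd]
      · apply hy'.2
        rw [e]
        exact hA.combo_interior_self_mem_interior hq hy.1 (by linarith) hr0.le (by ring)
    · have hS : ∀ ε : ℝ, ε ≠ 0 → ∃ S, S = {x : Pt | x ∈ frontier A ∧ r • x + d ∈ frontier A ∧
          0 ≤ ε * hmcr (q - (r • q + d)) (x - q)} ∧
          ((∃ a b : Pt, S = segment ℝ a b) ∨ (∃ a : Pt, S = {a}) ∨ S = ∅) := by
        intro ε hε
        refine ⟨_, rfl, hm_isSeg _ ?_ (hm_conv hA hAcl hr0 hr1 d q hq hq' hvq ε hε) ?_⟩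
        · refine hfc.of_isClosed_subset ?_ (fun x hx => hx.1)
          have c1 : IsClosed {x : Pt | r • x + d ∈ frontier A} :=
            (isClosed_frontier (s := A)).preimage φ.continuous
          have c2 : IsClosed {x : Pt | 0 ≤ ε * hmcr (q - (r • q + d)) (x - q)} := by
            refine isClosed_le continuous_const ?_
            simp only [hmcr]
            fun_prop
          exact (isClosed_frontier (s := A)).inter (c1.inter c2)
        · rw [← Set.subset_empty_iff, ← hfi]
          exact interior_mono (fun x hx => hx.1)
      obtain ⟨S1, h1, h1'⟩ := hS 1 one_ne_zero
      obtain ⟨S2, h2, h2'⟩ := hS (-1) (by norm_num)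
      refine ⟨S1, S2, ?_, h1', h2'⟩
      rw [h1, h2, hfB]
      ext x
      simp only [Set.mem_inter_iff, Set.mem_preimage, hφ, Set.mem_union, Set.mem_ofPred_eq]
      constructor
      · rintro ⟨ha, hb⟩
        rcases le_total 0 (hmcr (q - (r • q + d)) (x - q)) with h | h
        · exact Or.inl ⟨ha, hb, by linarith⟩
        · exact Or.inr ⟨ha, hb, by linarith⟩
      · rintro (h | h) <;> exact ⟨h.1, h.2.1⟩
  · have hd : Disjoint (interior A) (interior B) :=
      Set.disjoint_iff_inter_eq_empty.2 (Set.not_nonempty_iff_eq_empty.1 hdis)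
    have hBi : (interior B).Nonempty := by
      rw [hiB]
      obtain ⟨a, ha⟩ := hAi
      exact ⟨φ.symm a, by simpa using ha⟩
    have hclA : closure (interior A) = A := by
      rw [hA.closure_interior_eq_closure_of_nonempty_interior hAi, hAcl.closure_eq]
    have hclB : closure (interior B) = B := by
      rw [hBconv.closure_interior_eq_closure_of_nonempty_interior hBi, hBcl.closure_eq]
    have d1 : Disjoint (interior A) B := by
      have := hd.closure_right isOpen_interior
      rwa [hclB] at this
    have d2 : Disjoint A (interior B) := by
      have := hd.closure_left isOpen_interior
      rwa [hclA] at this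
    have hD : frontier A ∩ frontier B = A ∩ B := by
      rw [hAcl.frontier_eq, hBcl.frontier_eq]
      ext x
      constructor
      · rintro ⟨h, h'⟩; exact ⟨h.1, h'.1⟩
      · rintro ⟨h, h'⟩
        exact ⟨⟨h, fun hh => Set.disjoint_left.1 d1 hh h'⟩,
          ⟨h', fun hh => Set.disjoint_left.1 d2 h hh⟩⟩
    refine ⟨A ∩ B, ∅, by rw [hD, Set.union_empty], ?_, Or.inr (Or.inr rfl)⟩
    refine hm_isSeg _ (hAc.inter_right hBcl) (hA.inter hBconv) ?_
    rw [← hD, ← Set.subset_empty_iff, ← hfi]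
    exact interior_mono Set.inter_subset_left

lemma hm_hom {C : Set Pt} (hCc : IsCompact C) (hCconv : Convex ℝ C)
    (hCint : (interior C).Nonempty) {x y : Pt} {l m : ℝ} (hl : 0 < l) (hlm : l ≤ m)
    {A B : Set Pt} (hA : A = (fun z => x + l • z) '' C) (hB : B = (fun z => y + m • z) '' C)
    (hAB : A ≠ B) :
    ∃ S₁ S₂ : Set Pt, frontier A ∩ frontier B = S₁ ∪ S₂ ∧
      ((∃ a b : Pt, S₁ = segment ℝ a b) ∨ (∃ a : Pt, S₁ = {a}) ∨ S₁ = ∅) ∧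
      ((∃ a b : Pt, S₂ = segment ℝ a b) ∨ (∃ a : Pt, S₂ = {a}) ∨ S₂ = ∅) := by
  have hm : 0 < m := lt_of_lt_of_le hl hlm
  let φ : Pt ≃ₜ Pt := (Homeomorph.smulOfNeZero l hl.ne').trans (Homeomorph.addLeft x)
  have hA' : A = φ '' C := hA
  refine hm_main (r := l / m) (d := x - (l / m) • y) ?_ ?_ ?_ (by positivity)
    ((div_le_one hm).2 hlm) ?_ hAB
  · rw [hA]
    rintro _ ⟨u, hu, rfl⟩ _ ⟨w, hw, rfl⟩ a b ha hb hab
    refine ⟨a • u + b • w, hCconv hu hw ha hb hab, ?_⟩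
    have : a = 1 - b := by linarith
    subst this
    module
  · rw [hA']; exact hCc.image φ.continuous
  · rw [hA', ← φ.image_interior]; exact hCint.image _
  · ext w
    rw [hA, hB]
    simp only [Set.mem_image, Set.mem_preimage]
    constructor
    · rintro ⟨z, hz, rfl⟩
      refine ⟨z, hz, ?_⟩
      have : l = l / m * m := by field_simp
      generalize l / m = t at *
      subst this
      module
    · rintro ⟨z, hz, h⟩
      refine ⟨z, hz, ?_⟩
      have h2 : (l / m) • (y + m • z) = (l / m) • w := by
        have e : l / m * m = l := by field_simp
        rw [smul_add, smul_smul, e]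
        have : l • z = (l / m) • w + (x - (l / m) • y) - x := by rw [← h]; abel
        rw [this]; abel
      exact smul_right_injective Pt (div_pos hl hm).ne' h2

/-- The intersection of the boundaries of two distinct homothets of a compact convex
set `C ⊆ ℝ²` with nonempty interior is the union of two sets, each of which is either
a closed line segment, a single point, or empty. -/
theorem stmt_0 (C : Set Pt) (hCc : IsCompact C) (hCconv : Convex ℝ C)
    (hCint : (interior C).Nonempty)
    (A B : Set Pt) (hA : IsHomothet C A) (hB : IsHomothet C B) (hAB : A ≠ B) :
    ∃ S₁ S₂ : Set Pt, frontier A ∩ frontier B = S₁ ∪ S₂ ∧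
      ((∃ a b : Pt, S₁ = segment ℝ a b) ∨ (∃ a : Pt, S₁ = {a}) ∨ S₁ = ∅) ∧
      ((∃ a b : Pt, S₂ = segment ℝ a b) ∨ (∃ a : Pt, S₂ = {a}) ∨ S₂ = ∅) := by
  obtain ⟨x, l, hl, hA⟩ := hA
  obtain ⟨y, m, hm, hB⟩ := hB
  rcases le_total l m with h | h
  · exact hm_hom hCc hCconv hCint hl h hA hB hAB
  · rw [Set.inter_comm]
    exact hm_hom hCc hCconv hCint hm h hB hA hAB.symm
end
end

section
/- Let C be a compact convex set in the plane ℝ² with nonempty interior, let A and B be homothets of C, let p, q be points on the boundary of A, and let r, s be points on the boundary of B. If the segments pq and rs intersect properly (i.e., they meet in a point lying in the relative interior of both segments) and none of p, q lies on segment rs and none of r, s lies on segment pq, then at least one of the following holds: p ∈ B, q ∈ B, r ∈ A, or s ∈ A. -/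
noncomputable section

open Real

lemma aux_key (A : Set Pt) (hA : Convex ℝ A) (m P R : Pt) (a b k : ℝ) (ha : 0 ≤ a) (hb : 0 ≤ b)
    (hk : 0 < k) (hm : m ∈ A) (hp : m + P ∈ A) (hm' : m + (b • R - a • P) ∈ A)
    (hu : m + (b • R - a • P) + k • R ∈ A) :
    m + (b • R - a • P) + k • P ∈ A ∨ m + R ∈ A := by
  rcases le_total (b + k) (1 + a) with h | h
  · left
    have hbk : 0 < b + k := by linarith
    have h1a : 0 < 1 + a := by linarith
    -- point at height b on the segment from p to u
    have h1 := hA hp hu (a := k / (b + k)) (b := b / (b + k)) (by positivity) (by positivity)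
      (by field_simp; ring)
    have h2 := hA hm' h1 (a := 1 - (b + k) / (1 + a)) (b := (b + k) / (1 + a))
      (by rw [sub_nonneg, div_le_one h1a]; exact h) (by positivity) (by ring)
    convert h2 using 1
    match_scalars <;> field_simp <;> ring
  · right
    have h1a : 0 < 1 + a := by linarith
    have hbk : 0 < b + k := by linarith
    have h1 := hA hp hu (a := a / (1 + a)) (b := 1 / (1 + a)) (by positivity) (by positivity)
      (by field_simp; ring)
    have h2 := hA hm h1 (a := 1 - (1 + a) / (b + k)) (b := (1 + a) / (b + k))
      (by rw [sub_nonneg, div_le_one hbk]; exact h) (by positivity) (by ring)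
    convert h2 using 1
    match_scalars <;> field_simp <;> ring

lemma aux_ray (m P : Pt) (c : ℝ) (hc : 0 < c) :
    m + c • P ∈ segment ℝ m (m + P) ∨ m + P ∈ segment ℝ m (m + c • P) := by
  rcases le_total c 1 with h | h
  · left
    refine ⟨1 - c, c, by linarith, hc.le, by ring, ?_⟩
    module
  · right
    refine ⟨1 - 1 / c, 1 / c, ?_, by positivity, by ring, ?_⟩
    · rw [sub_nonneg, div_le_one hc]; exact h
    · match_scalars <;> field_simp <;> ring

lemma aux_span (P R : Pt) (hP : P ≠ 0) :
    (∃ c : ℝ, R = c • P) ∨ ∀ D : Pt, ∃ x y : ℝ, D = x • P + y • R := by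
  by_cases hd : P 0 * R 1 - P 1 * R 0 = 0
  · left
    by_cases h0 : P 0 = 0
    · have h1 : P 1 ≠ 0 := by
        intro h1
        apply hP
        ext i
        fin_cases i <;> simp [h0, h1]
      refine ⟨R 1 / P 1, ?_⟩
      ext i
      fin_cases i
      · simp [h0]
        have : P 1 * R 0 = 0 := by rw [h0] at hd; linarith
        exact (mul_eq_zero.mp this).resolve_left h1
      · simp; field_simp
    · refine ⟨R 0 / P 0, ?_⟩
      ext i
      fin_cases i
      · simp; field_simp
      · simp; field_simp; linarith
  · right
    intro D
    refine ⟨(D 0 * R 1 - D 1 * R 0) / (P 0 * R 1 - P 1 * R 0),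
      (P 0 * D 1 - P 1 * D 0) / (P 0 * R 1 - P 1 * R 0), ?_⟩
    ext i
    fin_cases i
    · simp
      rw [div_mul_eq_mul_div, div_mul_eq_mul_div, ← add_div, eq_div_iff hd]; ring
    · simp
      rw [div_mul_eq_mul_div, div_mul_eq_mul_div, ← add_div, eq_div_iff hd]; ring

lemma aux_hom (C A B : Set Pt) (hA : IsHomothet C A) (hB : IsHomothet C B) (m : Pt) :
    ∃ (D : Pt) (k : ℝ), 0 < k ∧ ∀ V : Pt, m + V ∈ B ↔ m + D + k • V ∈ A := by
  obtain ⟨x, a, ha, rfl⟩ := hA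
  obtain ⟨y, b, hb, rfl⟩ := hB
  refine ⟨x + (a / b) • (m - y) - m, a / b, by positivity, fun V => ⟨?_, ?_⟩⟩
  · rintro ⟨z, hz, h⟩
    refine ⟨z, hz, ?_⟩
    have hV : V = y + b • z - m := by
      rw [eq_sub_iff_add_eq, add_comm]; exact h.symm
    subst hV
    match_scalars <;> field_simp <;> ring
  · rintro ⟨z, hz, h⟩
    refine ⟨z, hz, ?_⟩
    have hz' : a • z = (a / b) • (m - y) + (a / b) • V := by
      have h' : x + a • z = x + ((a / b) • (m - y) + (a / b) • V) := by
        refine Eq.trans h ?_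
        module
      exact add_left_cancel h'
    have hz2 : b • z = (b / a) • (a • z) := by
      rw [smul_smul]; congr 1; field_simp
    show y + b • z = m + V
    rw [hz2, hz']
    match_scalars <;> field_simp <;> ring

lemma aux_closed (C A : Set Pt) (hC : IsCompact C) (hA : IsHomothet C A) : IsClosed A := by
  obtain ⟨x, a, ha, rfl⟩ := hA
  exact (hC.image (by fun_prop)).isClosed

lemma aux_convex (C A : Set Pt) (hC : Convex ℝ C) (hA : IsHomothet C A) : Convex ℝ A := by
  obtain ⟨x, a, ha, rfl⟩ := hA
  rintro _ ⟨u, hu, rfl⟩ _ ⟨v, hv, rfl⟩ s t hs ht hst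
  refine ⟨s • u + t • v, hC hu hv hs ht hst, ?_⟩
  have : s = 1 - t := by linarith
  subst this
  module

lemma aux_opp (p q m : Pt) (h : m ∈ openSegment ℝ p q) :
    ∃ (P : Pt) (l : ℝ), 0 < l ∧ p = m + P ∧ q = m + (-l) • P := by
  obtain ⟨a, b, ha, hb, hab, rfl⟩ := h
  refine ⟨p - (a • p + b • q), a / b, by positivity, by module, ?_⟩
  have : a = 1 - b := by linarith
  subst this
  match_scalars <;> field_simp <;> ring

/-- If segments `pq` and `rs`, with endpoints on the boundaries of homothets `A` and
`B` of `C` respectively, intersect properly and none of the four endpoints lies on the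
other segment, then one of `p, q` lies in `B` or one of `r, s` lies in `A`. -/
theorem stmt_1 (C : Set Pt) (hCc : IsCompact C) (hCconv : Convex ℝ C)
    (hCint : (interior C).Nonempty)
    (A B : Set Pt) (hA : IsHomothet C A) (hB : IsHomothet C B)
    (p q r s : Pt) (hp : p ∈ frontier A) (hq : q ∈ frontier A)
    (hr : r ∈ frontier B) (hs : s ∈ frontier B)
    (hcross : properInter p q r s)
    (hpn : p ∉ segment ℝ r s) (hqn : q ∉ segment ℝ r s)
    (hrn : r ∉ segment ℝ p q) (hsn : s ∉ segment ℝ p q) :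
    p ∈ B ∨ q ∈ B ∨ r ∈ A ∨ s ∈ A := by
  have hAc := aux_convex C A hCconv hA
  have hBc := aux_convex C B hCconv hB
  replace hp := (aux_closed C A hCc hA).frontier_subset hp
  replace hq := (aux_closed C A hCc hA).frontier_subset hq
  replace hr := (aux_closed C B hCc hB).frontier_subset hr
  replace hs := (aux_closed C B hCc hB).frontier_subset hs
  obtain ⟨m, hm1, hm2⟩ := hcross
  have hmA : m ∈ A := hAc.segment_subset hp hq (openSegment_subset_segment _ _ _ hm1)
  have hmB : m ∈ B := hBc.segment_subset hr hs (openSegment_subset_segment _ _ _ hm2)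
  obtain ⟨D, k, hk, hAB⟩ := aux_hom C A B hA hB m
  obtain ⟨P, l, hl, rfl, rfl⟩ := aux_opp p q m hm1
  obtain ⟨R, n, hn, rfl, rfl⟩ := aux_opp r s m hm2
  have hm' : m + D ∈ A := by
    have := (hAB 0).1 (by simpa using hmB)
    simpa using this
  have hP : P ≠ 0 := by
    rintro rfl
    apply hpn
    simpa using openSegment_subset_segment _ _ _ hm2
  have hR : R ≠ 0 := by
    rintro rfl
    apply hrn
    simpa using openSegment_subset_segment _ _ _ hm1
  -- the general step, in terms of direction vectors
  have key : ∀ (P' R' : Pt) (a b : ℝ), 0 ≤ a → 0 ≤ b → D = b • R' - a • P' →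
      m + P' ∈ A → m + R' ∈ B → m + P' ∈ B ∨ m + R' ∈ A := by
    intro P' R' a b ha hb hD hP' hR'
    have h1 := (hAB R').1 hR'
    rw [hAB P']
    subst hD
    exact aux_key A hAc m P' R' a b k ha hb hk hmA hP' hm' h1
  rcases aux_span P R hP with ⟨c, hc⟩ | hspan
  · have hc0 : c ≠ 0 := by
      rintro rfl
      apply hR
      simpa using hc
    subst hc
    rcases lt_or_gt_of_ne hc0 with h | h
    · have hcP : c • P = (-c / l) • ((-l) • P) := by
        rw [smul_smul]; congr 1; field_simp
      have := aux_ray m ((-l) • P) (-c / l) (div_pos (by linarith) hl)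
      rw [← hcP] at this
      rcases this with h | h
      · exact Or.inr (Or.inr (Or.inl (hAc.segment_subset hmA hq h)))
      · exact Or.inr (Or.inl (hBc.segment_subset hmB hr h))
    · rcases aux_ray m P c h with h | h
      · exact Or.inr (Or.inr (Or.inl (hAc.segment_subset hmA hp h)))
      · exact Or.inl (hBc.segment_subset hmB hr h)
  · obtain ⟨x, y, hD⟩ := hspan D
    rcases le_total x 0 with hx | hx <;> rcases le_total y 0 with hy | hy
    · have := key P ((-n) • R) (-x) (-y / n) (by linarith) (div_nonneg (by linarith) hn.le)
        (by rw [hD]; match_scalars <;> field_simp) hp hs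
      tauto
    · have := key P R (-x) y (by linarith) hy (by rw [hD]; module) hp hr
      tauto
    · have := key ((-l) • P) ((-n) • R) (x / l) (-y / n) (by positivity)
        (div_nonneg (by linarith) hn.le)
        (by rw [hD]; match_scalars <;> field_simp) hq hs
      tauto
    · have := key ((-l) • P) R (x / l) y (by positivity) hy
        (by rw [hD]; match_scalars <;> field_simp) hq hr
      tauto
end
end
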